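/- With Q_n(λ,μ) as above, let F(θ) = 4 − 2θ − θ², let X₂ = {−1}, and for m ≥ 3 let X_m = {θ ∈ ℝ : F(θ) ∈ X_{m−1}}; let H_θ(λ,μ) = μ² − λμ − 2λ² − 2 − μ + θλ. Then for every m ≥ 2 the set X_m is finite with exactly 2^{m−2} elements, all lying in [−4,5]; and for every n ≥ 2 and all real λ, μ one has the factorization det Q_n(λ,μ) = (2 + 2λ − μ)(2 − λ − μ)^{3^{n−1}+1} · ∏_{m=2}^{n} ∏_{θ ∈ X_m} H_θ(λ,μ)^{3^{n−m}+1}. -/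

import Mathlib

open Matrix

/-- The level-`n` action of the generator `a` of the Fabrykowski–Gupta group on ternary
words of length `n`: `a_n(xv) = ((x+1) mod 3)·v`, `a₀ = id`. -/
def fgA : (n : ℕ) → (Fin n → Fin 3) → (Fin n → Fin 3)
  | 0, v => v
  | _ + 1, v => Fin.cons (v 0 + 1) (Fin.tail v)

/-- The level-`n` action of the generator `s` of the Fabrykowski–Gupta group:
`s_n(0v) = 0·a_{n−1}(v)`, `s_n(1v) = 1·v`, `s_n(2v) = 2·s_{n−1}(v)`, `s₀ = id`. -/
def fgS : (n : ℕ) → (Fin n → Fin 3) → (Fin n → Fin 3)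
  | 0, v => v
  | n + 1, v =>
    if v 0 = 0 then Fin.cons 0 (fgA n (Fin.tail v))
    else if v 0 = 2 then Fin.cons 2 (fgS n (Fin.tail v))
    else v

/-- The real permutation matrix of a map `f` of a finite set. -/
def permMat {I : Type*} [Fintype I] [DecidableEq I] (f : I → I) : Matrix I I ℝ :=
  Matrix.of fun i j => if f j = i then 1 else 0

/-- `A_n = a_n + a_nᵀ`. -/
noncomputable def fgAmat (n : ℕ) : Matrix (Fin n → Fin 3) (Fin n → Fin 3) ℝ :=
  permMat (fgA n) + (permMat (fgA n))ᵀ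

/-- `S_n = s_n + s_nᵀ`. -/
noncomputable def fgSmat (n : ℕ) : Matrix (Fin n → Fin 3) (Fin n → Fin 3) ℝ :=
  permMat (fgS n) + (permMat (fgS n))ᵀ

/-- `Q_n(λ,μ) = S_n + λ·A_n − μ·I`. -/
noncomputable def fgQ (n : ℕ) (lam mu : ℝ) : Matrix (Fin n → Fin 3) (Fin n → Fin 3) ℝ :=
  fgSmat n + lam • fgAmat n - mu • (1 : Matrix (Fin n → Fin 3) (Fin n → Fin 3) ℝ)

/-- The preimage sets `X_m`: `X₂ = {−1}`, `X_m = F⁻¹(X_{m−1})` for `m ≥ 3`, where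
`F(θ) = 4 − 2θ − θ²`. (`X₀`, `X₁` are irrelevant and set to `∅`.) -/
def Xset : ℕ → Set ℝ
  | 0 => ∅
  | 1 => ∅
  | 2 => {-1}
  | m + 3 => {θ : ℝ | (4 - 2 * θ - θ ^ 2) ∈ Xset (m + 2)}

/-- `H_θ(λ,μ) = μ² − λμ − 2λ² − 2 − μ + θλ`. -/
def Hquad (θ lam mu : ℝ) : ℝ := mu ^ 2 - lam * mu - 2 * lam ^ 2 - 2 - mu + θ * lam

/-- A Schur complement formula in which `W` solves `M * W = B`; no inverse is needed. -/
lemma det_fromBlocks_of_mul_eq {U V : Type*} [Fintype U] [Fintype V] [DecidableEq U]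
    [DecidableEq V] {M : Matrix U U ℝ} {B W : Matrix U V ℝ} (C : Matrix V U ℝ)
    (D : Matrix V V ℝ) (h : M * W = B) :
    (fromBlocks M B C D).det = M.det * (D - C * W).det := by
  have h1 : fromBlocks M B C D * fromBlocks 1 (-W) 0 1 = fromBlocks M 0 C (D - C * W) := by
    rw [fromBlocks_multiply]
    congr 1 <;> simp [h, sub_eq_neg_add]
  have h2 := congrArg Matrix.det h1
  rwa [det_mul, det_fromBlocks_zero₂₁, det_fromBlocks_zero₁₂, det_one, det_one, one_mul,
    mul_one] at h2

lemma fgAmat_cons (n : ℕ) (a b : Fin 3) (u v : Fin n → Fin 3) :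
    fgAmat (n + 1) (Fin.cons a u) (Fin.cons b v) =
      (if a = b then 0 else 1) * (1 : Matrix (Fin n → Fin 3) (Fin n → Fin 3) ℝ) u v := by
  simp only [fgAmat, permMat, fgA, Matrix.add_apply, Matrix.transpose_apply, Matrix.of_apply,
    Fin.cons_zero, Fin.tail_cons, Fin.cons_inj, Matrix.one_apply, eq_comm (a := v)]
  by_cases h : u = v
  · fin_cases a <;> fin_cases b <;> simp [h]
  · simp [h]

lemma fgSmat_cons (n : ℕ) (a b : Fin 3) (u v : Fin n → Fin 3) :
    fgSmat (n + 1) (Fin.cons a u) (Fin.cons b v) =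
      if a = b then
        (if a = 0 then fgAmat n u v else if a = 1 then
          2 * (1 : Matrix (Fin n → Fin 3) (Fin n → Fin 3) ℝ) u v else fgSmat n u v)
      else 0 := by
  simp only [fgSmat, fgAmat, permMat, fgS, Matrix.add_apply, Matrix.transpose_apply,
    Matrix.of_apply, Fin.cons_zero, Fin.tail_cons, Matrix.one_apply]
  fin_cases a <;> fin_cases b <;> simp [Fin.cons_inj, eq_comm (a := v)]
  split_ifs <;> norm_num

lemma one_cons (n : ℕ) (a b : Fin 3) (u v : Fin n → Fin 3) :
    (1 : Matrix (Fin (n + 1) → Fin 3) (Fin (n + 1) → Fin 3) ℝ) (Fin.cons a u) (Fin.cons b v) =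
      if a = b then (1 : Matrix (Fin n → Fin 3) (Fin n → Fin 3) ℝ) u v else 0 := by
  simp only [Matrix.one_apply, Fin.cons_inj]
  split_ifs <;> simp_all

/-- Words of length `n + 1` as pairs of a first letter and a tail. -/
def headTail (n : ℕ) : Fin 3 × (Fin n → Fin 3) ≃ (Fin (n + 1) → Fin 3) :=
  Fin.consEquiv fun _ => Fin 3

lemma one_submatrix (n : ℕ) :
    (1 : Matrix (Fin (n + 1) → Fin 3) (Fin (n + 1) → Fin 3) ℝ).submatrix
      (headTail n) (headTail n) = kroneckerMap (· * ·) 1 1 := by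
  rw [Matrix.one_kronecker_one, Matrix.submatrix_one_equiv]

lemma fgAmat_submatrix (n : ℕ) :
    (fgAmat (n + 1)).submatrix (headTail n) (headTail n) =
      kroneckerMap (· * ·) !![0, 1, 1; 1, 0, 1; 1, 1, 0]
        (1 : Matrix (Fin n → Fin 3) (Fin n → Fin 3) ℝ) := by
  ext ⟨a, u⟩ ⟨b, v⟩
  change fgAmat (n + 1) (Fin.cons a u) (Fin.cons b v) = _
  rw [fgAmat_cons]
  fin_cases a <;> fin_cases b <;> simp

lemma fgAmat_mul_self (n : ℕ) :
    fgAmat (n + 1) * fgAmat (n + 1) = fgAmat (n + 1) + (2 : ℝ) • 1 := by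
  apply (Matrix.reindex (headTail n).symm (headTail n).symm).injective
  simp only [Matrix.reindex_apply, Equiv.symm_symm]
  rw [← Matrix.submatrix_mul_equiv _ _ _ (headTail n) _]
  simp only [Matrix.submatrix_add, Matrix.submatrix_smul, Pi.add_apply, Pi.smul_apply,
    fgAmat_submatrix, one_submatrix]
  rw [← Matrix.mul_kronecker_mul, ← Matrix.smul_kronecker, ← Matrix.add_kronecker, one_mul]
  congr 1
  ext a b
  fin_cases a <;> fin_cases b <;> simp [Matrix.mul_apply, Fin.sum_univ_three] <;> norm_num

lemma det_smul_fgAmat_add (n : ℕ) (x y : ℝ) :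
    (y • fgAmat (n + 1) + x • 1).det =
      (x + 2 * y) ^ 3 ^ n * (x - y) ^ (2 * 3 ^ n) := by
  rw [← Matrix.det_submatrix_equiv_self (headTail n)]
  simp only [Matrix.submatrix_add, Matrix.submatrix_smul, Pi.add_apply, Pi.smul_apply,
    fgAmat_submatrix, one_submatrix]
  rw [← Matrix.smul_kronecker, ← Matrix.smul_kronecker, ← Matrix.add_kronecker,
    Matrix.det_kronecker, Matrix.det_fin_three, Matrix.det_one, one_pow, mul_one, pow_mul,
    ← mul_pow]
  simp
  ring

/-- Words of length `n + 1` split by their first letter, in the order `1, 0, 2`. -/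
noncomputable def splitWords (n : ℕ) :
    (Fin n → Fin 3) ⊕ ((Fin n → Fin 3) ⊕ (Fin n → Fin 3)) ≃ (Fin (n + 1) → Fin 3) :=
  Equiv.ofBijective
    (Sum.elim (fun v => Fin.cons 1 v) (Sum.elim (fun v => Fin.cons 0 v) fun v => Fin.cons 2 v))
    (by
      constructor
      · rintro (u | u | u) (v | v | v) h <;> simp [Fin.cons_inj] at h <;> simp [h]
      · intro w
        rw [← Fin.cons_self_tail w]
        generalize w 0 = a
        fin_cases a
        · exact ⟨Sum.inr (Sum.inl (Fin.tail w)), rfl⟩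
        · exact ⟨Sum.inl (Fin.tail w), rfl⟩
        · exact ⟨Sum.inr (Sum.inr (Fin.tail w)), rfl⟩)

lemma fgQ_submatrix (n : ℕ) (lam mu : ℝ) :
    (fgQ (n + 1) lam mu).submatrix (splitWords n) (splitWords n) =
      fromBlocks ((2 - mu) • 1) (fromCols (lam • 1) (lam • 1)) (fromRows (lam • 1) (lam • 1))
        (fromBlocks (fgAmat n - mu • 1) (lam • 1) (lam • 1) (fgSmat n - mu • 1)) := by
  ext (u | u | u) (v | v | v) <;>
    simp [splitWords, Equiv.ofBijective, fgQ, fgAmat_cons, fgSmat_cons, one_cons]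
  ring

/-- The Schur complement step, for spectral parameters away from the exceptional curves. -/
lemma det_fgQ_succ (k : ℕ) {lam mu : ℝ} (hd : 2 - mu ≠ 0) (hx : 2 - lam - mu ≠ 0)
    (hy : 2 + lam - mu ≠ 0) (hE : mu ^ 2 - mu - 2 - lam ^ 2 ≠ 0) :
    (fgQ (k + 2) lam mu).det =
      ((2 - lam - mu) * (2 + lam - mu)) ^ 3 ^ k *
        (mu ^ 2 - mu - 2 - lam ^ 2) ^ (2 * 3 ^ k) *
        (fgQ (k + 1)
          (lam ^ 2 * (2 - lam - mu) / ((mu ^ 2 - mu - 2 - lam ^ 2) * (2 + lam - mu)))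
          (mu + 2 * lam ^ 2 * (mu ^ 2 - 2 * mu - lam ^ 2 - lam) /
            ((mu ^ 2 - mu - 2 - lam ^ 2) * (2 + lam - mu)))).det := by
  rw [← Matrix.det_submatrix_equiv_self (splitWords (k + 1)), fgQ_submatrix]
  set I : Matrix (Fin (k + 1) → Fin 3) (Fin (k + 1) → Fin 3) ℝ := 1 with hI
  have hW : ((2 - mu) • I) * fromCols ((lam / (2 - mu)) • I) ((lam / (2 - mu)) • I) =
      fromCols (lam • I) (lam • I) := by
    rw [Matrix.mul_fromCols]
    simp [hI, smul_smul, div_mul_cancel₀ _ hd]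
  rw [det_fromBlocks_of_mul_eq _ _ hW]
  set a := mu + lam ^ 2 / (2 - mu) with ha
  set b := lam - lam ^ 2 / (2 - mu) with hb
  have h2 : fromBlocks (fgAmat (k + 1) - mu • I) (lam • I) (lam • I) (fgSmat (k + 1) - mu • I) -
      (fromRows (lam • I) (lam • I) : Matrix _ _ ℝ) *
        (fromCols ((lam / (2 - mu)) • I) ((lam / (2 - mu)) • I) : Matrix _ _ ℝ) =
      fromBlocks ((1 : ℝ) • fgAmat (k + 1) + (-a) • I) (b • I) (b • I)
        (fgSmat (k + 1) - a • I) := by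
    rw [Matrix.fromRows_mul_fromCols]
    ext (u | u) (v | v) <;> simp [hI, ha, hb] <;> ring
  rw [h2]
  have two_sub_a : 2 - a = (2 - lam - mu) * (2 + lam - mu) / (2 - mu) := by rw [ha]; field_simp; ring
  have one_add_a : 1 + a = -(mu ^ 2 - mu - 2 - lam ^ 2) / (2 - mu) := by rw [ha]; field_simp; ring
  have h2a : 2 - a ≠ 0 := by rw [two_sub_a]; positivity
  have h1a : 1 + a ≠ 0 := by rw [one_add_a]; exact div_ne_zero (neg_ne_zero.mpr hE) hd
  set q := b / ((2 - a) * (1 + a)) with hq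
  have hbq : (2 * q - a * ((a - 1) * q)) = b := by rw [hq]; field_simp; ring
  have hW' : ((1 : ℝ) • fgAmat (k + 1) + (-a) • I) * (((a - 1) * q) • I + q • fgAmat (k + 1)) =
      b • I := by
    simp only [hI, add_mul, mul_add, one_smul, smul_mul_assoc, mul_smul_comm, mul_one, one_mul,
      fgAmat_mul_self]
    rw [← hbq]
    module
  rw [det_fromBlocks_of_mul_eq _ _ hW', det_smul_fgAmat_add]
  have hQ : fgSmat (k + 1) - a • I - b • I * (((a - 1) * q) • I + q • fgAmat (k + 1)) =
      fgQ (k + 1) (-(b * q)) (a + b * ((a - 1) * q)) := by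
    simp only [hI, fgQ, smul_mul_assoc, one_mul]
    module
  have hbd : b = lam * (2 - lam - mu) / (2 - mu) := by rw [hb]; field_simp; ring
  have hqE : q = -(lam * (2 - lam - mu) * (2 - mu)) /
      ((2 - lam - mu) * (2 + lam - mu) * (mu ^ 2 - mu - 2 - lam ^ 2)) := by
    rw [hq, hbd, two_sub_a, one_add_a]; field_simp
  have hl : -(b * q) =
      lam ^ 2 * (2 - lam - mu) / ((mu ^ 2 - mu - 2 - lam ^ 2) * (2 + lam - mu)) := by
    rw [hqE, hbd]; field_simp
  have hm : a + b * ((a - 1) * q) = mu + 2 * lam ^ 2 * (mu ^ 2 - 2 * mu - lam ^ 2 - lam) /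
            ((mu ^ 2 - mu - 2 - lam ^ 2) * (2 + lam - mu)) := by
    rw [hqE, hbd, ha]
    generalize hE' : mu ^ 2 - mu - 2 - lam ^ 2 = E at hE ⊢
    field_simp
    rw [← hE']
    ring
  rw [hQ, hl, hm, det_smul, det_one, mul_one, ← mul_assoc]
  congr 1
  have hc : Fintype.card (Fin (k + 1) → Fin 3) = 3 ^ k + 2 * 3 ^ k := by
    simp; ring
  rw [hc, pow_add]
  have e1 : (2 - lam - mu) * (2 + lam - mu) = (2 - mu) * (-a + 2 * 1) := by
    rw [ha]; field_simp; ring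
  have e2 : mu ^ 2 - mu - 2 - lam ^ 2 = (2 - mu) * (-a - 1) := by
    rw [ha]; field_simp; ring
  rw [e1, e2, mul_pow, mul_pow]
  ring

lemma det_fgQ_one (lam mu : ℝ) :
    (fgQ 1 lam mu).det = (2 + 2 * lam - mu) * (2 - lam - mu) ^ 2 := by
  have hS : fgSmat 1 = (2 : ℝ) • 1 := by
    ext u v
    rw [← Fin.cons_self_tail u, ← Fin.cons_self_tail v, fgSmat_cons, Matrix.smul_apply, one_cons]
    generalize u 0 = a
    generalize v 0 = b
    rw [Subsingleton.elim (Fin.tail u) (Fin.tail v)]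
    fin_cases a <;> fin_cases b <;> simp [fgAmat, fgSmat, permMat, fgA, fgS] <;> norm_num
  have h : fgQ 1 lam mu = lam • fgAmat (0 + 1) + (2 - mu) • 1 := by
    rw [fgQ, hS]; module
  rw [h, det_smul_fgAmat_add]
  ring

lemma Xset_subset (m : ℕ) : Xset (m + 2) ⊆ Set.Ico (-4 : ℝ) 5 := by
  induction m with
  | zero => simp [Xset]; norm_num
  | succ m ih =>
    intro t ht
    have h : 4 - 2 * t - t ^ 2 ∈ Set.Ico (-4 : ℝ) 5 := ih ht
    have h1 := h.1
    constructor <;> nlinarith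

/-- `X_{m+1}` is the union of the images of `X_m` under the two branches of `F⁻¹`. -/
lemma Xset_succ (m : ℕ) :
    Xset (m + 3) = (fun θ : ℝ => -1 + √(5 - θ)) '' Xset (m + 2) ∪
      (fun θ : ℝ => -1 - √(5 - θ)) '' Xset (m + 2) := by
  ext t
  simp only [Xset, Set.mem_ofPred_eq, Set.mem_union, Set.mem_image]
  constructor
  · intro ht
    have e : √(5 - (4 - 2 * t - t ^ 2)) = |t + 1| := by
      rw [← Real.sqrt_sq_eq_abs]; congr 1; ring
    rcases le_total 0 (t + 1) with h0 | h0
    · exact Or.inl ⟨_, ht, by rw [e, abs_of_nonneg h0]; ring⟩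
    · exact Or.inr ⟨_, ht, by rw [e, abs_of_nonpos h0]; ring⟩
  · rintro (⟨θ, hθ, rfl⟩ | ⟨θ, hθ, rfl⟩) <;>
    · have := Real.sq_sqrt (sub_nonneg.2 (Xset_subset m hθ).2.le)
      convert hθ using 1
      linarith

lemma sqrt_injOn_Xset (m : ℕ) : Set.InjOn (fun θ : ℝ => √(5 - θ)) (Xset (m + 2)) := by
  intro a ha b hb h
  have h1 := (Real.sqrt_inj (sub_nonneg.2 (Xset_subset m ha).2.le)
    (sub_nonneg.2 (Xset_subset m hb).2.le)).1 h
  linarith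

lemma Xset_succ_disjoint (m : ℕ) :
    Disjoint ((fun θ : ℝ => -1 + √(5 - θ)) '' Xset (m + 2))
      ((fun θ : ℝ => -1 - √(5 - θ)) '' Xset (m + 2)) := by
  rw [Set.disjoint_left]
  rintro _ ⟨a, ha, rfl⟩ ⟨b, hb, h⟩
  have h1 := Real.sqrt_pos.2 (sub_pos.2 (Xset_subset m ha).2)
  have h2 := Real.sqrt_nonneg (5 - b)
  simp only at h
  linarith

lemma Xset_finite_card (m : ℕ) :
    (Xset (m + 2)).Finite ∧ (Xset (m + 2)).ncard = 2 ^ m := by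
  induction m with
  | zero => simp [Xset]
  | succ m ih =>
    have hs := Xset_succ m
    have h1 := ih.1.image (fun θ : ℝ => -1 + √(5 - θ))
    have h2 := ih.1.image (fun θ : ℝ => -1 - √(5 - θ))
    refine ⟨hs ▸ h1.union h2, ?_⟩
    rw [hs, Set.ncard_union_eq (Xset_succ_disjoint m) h1 h2,
      Set.InjOn.ncard_image, Set.InjOn.ncard_image, ih.2]
    · ring
    · intro a ha b hb h
      exact sqrt_injOn_Xset m ha hb (by simpa using h)
    · intro a ha b hb h
      exact sqrt_injOn_Xset m ha hb (by simpa using h)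

/-- The product of the quadrics `H_θ` over `X_{m+2}`. -/
noncomputable def quadProd (m : ℕ) (lam mu : ℝ) : ℝ :=
  ∏ᶠ θ ∈ Xset (m + 2), Hquad θ lam mu

lemma quadProd_eq_prod (m : ℕ) (lam mu : ℝ) :
    quadProd m lam mu = ∏ θ ∈ (Xset_finite_card m).1.toFinset, Hquad θ lam mu :=
  finprod_mem_eq_finite_toFinset_prod _ _

lemma quadProd_zero (lam mu : ℝ) : quadProd 0 lam mu = Hquad (-1) lam mu := by
  simp [quadProd, Xset]

lemma quadProd_succ (m : ℕ) {lam mu lam' mu' c : ℝ}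
    (h : ∀ t : ℝ, ∀ r : ℝ, r ^ 2 = 5 - t →
      Hquad (-1 + r) lam mu * Hquad (-1 - r) lam mu = c * Hquad t lam' mu') :
    quadProd (m + 1) lam mu = c ^ 2 ^ m * quadProd m lam' mu' := by
  have hs := Xset_succ m
  have hf := (Xset_finite_card m).1
  have hc : 2 ^ m = hf.toFinset.card := by
    rw [← Set.ncard_eq_toFinset_card _ hf, (Xset_finite_card m).2]
  rw [quadProd, hs, finprod_mem_union (Xset_succ_disjoint m) (hf.image _) (hf.image _),
    finprod_mem_image, finprod_mem_image, ← finprod_mem_mul_distrib hf,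
    quadProd, finprod_mem_eq_finite_toFinset_prod _ hf, finprod_mem_eq_finite_toFinset_prod _ hf,
    hc, ← Finset.prod_const, ← Finset.prod_mul_distrib]
  · refine Finset.prod_congr rfl fun t ht => h t _ (Real.sq_sqrt ?_)
    exact sub_nonneg.2 (Xset_subset m (hf.mem_toFinset.1 ht)).2.le
  · intro a ha b hb h
    exact sqrt_injOn_Xset m ha hb (by simpa using h)
  · intro a ha b hb h
    exact sqrt_injOn_Xset m ha hb (by simpa using h)

lemma continuous_quadProd (m : ℕ) (lam : ℝ) : Continuous (quadProd m lam) := by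
  have h : quadProd m lam =
      fun mu => ∏ θ ∈ (Xset_finite_card m).1.toFinset, Hquad θ lam mu :=
    funext fun mu => quadProd_eq_prod m lam mu
  rw [h]
  unfold Hquad
  fun_prop

lemma sum_two_pow_mul (k : ℕ) :
    ∑ j ∈ Finset.range k, 2 ^ j * (3 ^ (k - 1 - j) + 1) + 1 = 3 ^ k := by
  have h : ∀ j ∈ Finset.range k, 2 ^ j * (3 ^ (k - 1 - j) + 1) =
      2 ^ j * 3 ^ (k - 1 - j) + 2 ^ j := fun j _ => by ring
  rw [Finset.sum_congr rfl h, Finset.sum_add_distrib]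
  have h1 := (Commute.all (2 : ℤ) 3).geom_sum₂_mul k
  have h2 := Commute.geom_sum₂_mul (Commute.all (2 : ℤ) 1) k
  zify
  simp at h2
  linarith

lemma dense_generic (lam : ℝ) :
    Dense {mu : ℝ | 2 - mu ≠ 0 ∧ 2 - lam - mu ≠ 0 ∧ 2 + lam - mu ≠ 0 ∧
      mu ^ 2 - mu - 2 - lam ^ 2 ≠ 0} := by
  have hf : ({2, 2 - lam, 2 + lam, (1 + √(9 + 4 * lam ^ 2)) / 2,
      (1 - √(9 + 4 * lam ^ 2)) / 2} : Set ℝ).Finite := Set.toFinite _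
  refine (hf.countable.dense_compl ℝ).mono fun mu h => ?_
  simp only [Set.mem_compl_iff, Set.mem_insert_iff, Set.mem_singleton_iff, not_or] at h
  obtain ⟨h1, h2, h3, h4, h5⟩ := h
  refine ⟨fun h => h1 (by linarith), fun h => h2 (by linarith), fun h => h3 (by linarith),
    fun h => ?_⟩
  have hs := Real.sq_sqrt (show 0 ≤ 9 + 4 * lam ^ 2 by positivity)
  have : (mu - (1 + √(9 + 4 * lam ^ 2)) / 2) * (mu - (1 - √(9 + 4 * lam ^ 2)) / 2) = 0 := by
    linarith
  rcases mul_eq_zero.1 this with h | h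
  · exact h4 (by linarith)
  · exact h5 (by linarith)

lemma det_fgQ_eq (k : ℕ) (lam mu : ℝ) :
    (fgQ (k + 1) lam mu).det = (2 + 2 * lam - mu) * (2 - lam - mu) ^ (3 ^ k + 1) *
      ∏ j ∈ Finset.range k, quadProd j lam mu ^ (3 ^ (k - 1 - j) + 1) := by
  induction k generalizing lam mu with
  | zero => simp [det_fgQ_one]
  | succ k ih =>
    refine congrFun (f := fun mu => (fgQ (k + 1 + 1) lam mu).det)
      (g := fun mu => (2 + 2 * lam - mu) * (2 - lam - mu) ^ (3 ^ (k + 1) + 1) *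
        ∏ j ∈ Finset.range (k + 1), quadProd j lam mu ^ (3 ^ (k + 1 - 1 - j) + 1))
      (Continuous.ext_on (dense_generic lam) ?_ ?_ ?_) mu
    · unfold fgQ
      fun_prop
    · have := fun j => continuous_quadProd j lam
      fun_prop
    rintro mu ⟨hd, hx, hy, hE⟩
    simp only
    rw [det_fgQ_succ k hd hx hy hE, ih, Finset.prod_range_succ', quadProd_zero]
    set x := 2 - lam - mu with hx'
    set y := 2 + lam - mu with hy'
    set E := mu ^ 2 - mu - 2 - lam ^ 2 with hE'
    set lam' := lam ^ 2 * x / (E * y) with hl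
    set mu' := mu + 2 * lam ^ 2 * (mu ^ 2 - 2 * mu - lam ^ 2 - lam) / (E * y) with hm
    have e1 : 2 + 2 * lam' - mu' = (2 + 2 * lam - mu) * x / y := by
      rw [hl, hm]
      field_simp
      rw [hx', hy', hE']
      ring
    have e2 : 2 - lam' - mu' = x * Hquad (-1) lam mu / E := by
      rw [hl, hm, Hquad]
      field_simp
      rw [hx', hy', hE']
      ring
    have e3 : ∀ j, quadProd (j + 1) lam mu = (E * y / x) ^ 2 ^ j * quadProd j lam' mu' := by
      intro j
      refine quadProd_succ j fun t r hr => ?_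
      obtain rfl : t = 5 - r ^ 2 := by linarith
      rw [hl, hm]
      simp only [Hquad]
      field_simp
      rw [hx', hy', hE']
      ring
    have e4 : ∏ j ∈ Finset.range k, quadProd (j + 1) lam mu ^ (3 ^ (k - (j + 1)) + 1) =
        (E * y / x) ^ (3 ^ k - 1) *
          ∏ j ∈ Finset.range k, quadProd j lam' mu' ^ (3 ^ (k - 1 - j) + 1) := by
      rw [← sum_two_pow_mul k, Nat.add_sub_cancel, ← Finset.prod_pow_eq_pow_sum,
        ← Finset.prod_mul_distrib]
      refine Finset.prod_congr rfl fun j _ => ?_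
      rw [e3, mul_pow, ← pow_mul, Nat.sub_sub, add_comm 1 j]
    simp only [Nat.add_sub_cancel, Nat.sub_zero]
    rw [e4, e1, e2]
    obtain ⟨N, hN⟩ : ∃ N, 3 ^ k = N + 1 :=
      Nat.exists_eq_succ_of_ne_zero (pow_ne_zero k (by norm_num))
    rw [pow_succ 3 k, hN, Nat.add_sub_cancel, show (N + 1) * 3 + 1 = N + N + N + 4 by ring,
      show 2 * (N + 1) = N + N + 2 by ring]
    generalize ∏ j ∈ Finset.range k, quadProd j lam' mu' ^ (3 ^ (k - 1 - j) + 1) = P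
    simp only [pow_add, mul_pow, div_pow]
    field_simp

/-- For each `m ≥ 2` the set `X_m` is finite with `2^(m−2)` elements, all in `[−4,5]`,
and for `n ≥ 2` the determinant `det Q_n(λ,μ)` factors as
`(2+2λ−μ)(2−λ−μ)^(3^(n−1)+1) ∏_{m=2}^{n} ∏_{θ∈X_m} H_θ(λ,μ)^(3^(n−m)+1)`. -/
theorem fabrykowski_gupta_det_factorization :
    (∀ m : ℕ, 2 ≤ m →
      (Xset m).Finite ∧ Nat.card (Xset m) = 2 ^ (m - 2) ∧
        Xset m ⊆ Set.Icc (-4 : ℝ) 5) ∧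
    (∀ n : ℕ, 2 ≤ n → ∀ lam mu : ℝ,
      (fgQ n lam mu).det =
        (2 + 2 * lam - mu) * (2 - lam - mu) ^ (3 ^ (n - 1) + 1) *
          ∏ m ∈ Finset.Icc 2 n, ∏ᶠ θ ∈ Xset m, Hquad θ lam mu ^ (3 ^ (n - m) + 1)) := by
  constructor
  · intro m hm
    obtain ⟨k, rfl⟩ := Nat.exists_eq_add_of_le' hm
    exact ⟨(Xset_finite_card k).1, (Xset_finite_card k).2,
      (Xset_subset k).trans Set.Ico_subset_Icc_self⟩
  · intro n hn lam mu
    obtain ⟨k, rfl⟩ := Nat.exists_eq_add_of_le' hn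
    rw [det_fgQ_eq (k + 1) lam mu]
    congr 1
    rw [← Finset.Ico_succ_right_eq_Icc, Finset.prod_Ico_eq_prod_range]
    refine Finset.prod_congr (by simp) fun j _ => ?_
    rw [quadProd_eq_prod, ← Finset.prod_pow, add_comm 2 j,
      finprod_mem_eq_finite_toFinset_prod _ (Xset_finite_card j).1]
    simp
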